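/- For each n ≥ 0 and each i ≥ 0, the set ℬ^{n,i} of strings x₁⋯x_k of degree n in the symbols {a, b, c, e} satisfying: (1) there are at most i occurrences of e, (2) every occurrence of the substring 'ca' comes after all occurrences of e, and (3) if there are fewer than i occurrences of e then there is no occurrence of 'ca', is a basis of the F₂-vector space V^{⊗n}. In particular ℬ^{n,0} is the standard monomial basis in the symbols {a, b, c}, and ℬ^{n,i} = ℬⁿ for i ≥ n/2. -/

import Mathlib

open TensorProduct PiTensorProduct

/-- The field `F₂`. -/
abbrev Ftwo := ZMod 2

/-- The 3-dimensional `F₂`-vector space `V` with basis `{a, b, c}`. -/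
abbrev V : Type := Fin 3 → Ftwo

/-- The basis vector `a` of `V`. -/
noncomputable def va : V := Pi.basisFun Ftwo (Fin 3) 0
/-- The basis vector `b` of `V`. -/
noncomputable def vb : V := Pi.basisFun Ftwo (Fin 3) 1
/-- The basis vector `c` of `V`. -/
noncomputable def vc : V := Pi.basisFun Ftwo (Fin 3) 2

/-- Graded multiplication (concatenation) of tensor powers of `V`. -/
noncomputable def tmulP {m n : ℕ} (x : ⨂[Ftwo]^m V) (y : ⨂[Ftwo]^n V) : ⨂[Ftwo]^(m+n) V :=
  @GradedMonoid.GMul.mul ℕ (fun i => ⨂[Ftwo]^i V) _ _ m n x y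

/-- The four symbols `a`, `b`, `c`, `e`. -/
inductive Symb : Type
  | A : Symb
  | B : Symb
  | C : Symb
  | E : Symb
deriving DecidableEq

/-- The degree of a symbol: `|a| = |b| = |c| = 1` and `|e| = 2`. -/
def Symb.deg : Symb → ℕ
  | .A => 1
  | .B => 1
  | .C => 1
  | .E => 2

/-- The degree of a string of symbols. -/
def degS (s : List Symb) : ℕ := (s.map Symb.deg).sum

/-- The element of `V^{⊗deg x}` corresponding to a symbol, where `e := a⊗c + c⊗a`. -/
noncomputable def symVal : (x : Symb) → ⨂[Ftwo]^(x.deg) V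
  | .A => tprod Ftwo ![va]
  | .B => tprod Ftwo ![vb]
  | .C => tprod Ftwo ![vc]
  | .E => tprod Ftwo ![va, vc] + tprod Ftwo ![vc, va]

/-- Interpretation of a string of symbols as an element of `V^{⊗n}`, interpreting
concatenation as the tensor product and substituting `e = a⊗c + c⊗a`. -/
noncomputable def interp : (s : List Symb) → ⨂[Ftwo]^(degS s) V
  | [] => @GradedMonoid.GOne.one ℕ (fun i => ⨂[Ftwo]^i V) _ _
  | x :: s => tmulP (symVal x) (interp s)

/-- Interpretation of a string of degree `n` as an element of `V^{⊗n}`. -/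
noncomputable def interpN (n : ℕ) (s : List Symb) (h : degS s = n) : ⨂[Ftwo]^n V :=
  TensorPower.cast Ftwo V h (interp s)

/-- `ℬⁿ`: the set of strings of degree `n` in the symbols `{a,b,c,e}` in which `ca` does
not occur as a substring. -/
def Bn (n : ℕ) : Set (List Symb) :=
  {s | degS s = n ∧ List.Chain' (fun x y => ¬(x = Symb.C ∧ y = Symb.A)) s}

/-- The family of elements of `V^{⊗n}` indexed by a set of strings of degree `n`. -/
noncomputable def interpFam (n : ℕ) (S : Set (List Symb)) (hS : ∀ s ∈ S, degS s = n)
    (s : S) : ⨂[Ftwo]^n V :=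
  interpN n s (hS s s.2)

/-- `ℬ^{n,i}`: the set of strings of degree `n` in `{a,b,c,e}` such that (1) there are at
most `i` occurrences of `e`, (2) every occurrence of the substring `ca` comes after all
occurrences of `e`, and (3) if there are fewer than `i` occurrences of `e` then there is
no occurrence of `ca`. -/
def Bni (n i : ℕ) : Set (List Symb) :=
  {s | degS s = n ∧
    s.count Symb.E ≤ i ∧
    (∀ j k : ℕ, j + 1 < s.length → s.getD j Symb.B = Symb.C → s.getD (j+1) Symb.B = Symb.A →
      k < s.length → s.getD k Symb.B = Symb.E → k < j) ∧
    (s.count Symb.E < i → List.Chain' (fun x y => ¬(x = Symb.C ∧ y = Symb.A)) s)}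

/-- A recursive description of conditions (1)-(3) in the definition of `Bni`. -/
def IsNormal : ℕ → List Symb → Prop
  | _, [] => True
  | 0, .E :: _ => False
  | i + 1, .E :: s => IsNormal i s
  | i, .C :: s => IsNormal i s ∧ (i ≠ 0 → s.head? ≠ some .A)
  | i, .A :: s => IsNormal i s
  | i, .B :: s => IsNormal i s

/-- Every occurrence of `ca` comes after all occurrences of `e`. -/
def CaAfterE (s : List Symb) : Prop :=
  ∀ j k : ℕ, j + 1 < s.length → s.getD j Symb.B = Symb.C → s.getD (j+1) Symb.B = Symb.A →
    k < s.length → s.getD k Symb.B = Symb.E → k < j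

theorem caAfterE_cons (x : Symb) (s : List Symb) :
    CaAfterE (x :: s) ↔ CaAfterE s ∧ (x = .C → s.head? = some .A → Symb.E ∉ s) := by
  constructor
  · intro h
    refine ⟨fun j k h1 h2 h3 h4 h5 => ?_, fun hx hs hE => ?_⟩
    · have := h (j + 1) (k + 1) (by simpa using h1) (by simpa using h2) (by simpa using h3)
        (by simpa using h4) (by simpa using h5)
      omega
    · obtain ⟨k, hk, hkE⟩ := List.mem_iff_getElem.1 hE
      cases s with
      | nil => simp at hs
      | cons y s =>
        have := h 0 (k + 1) (by simp) (by simpa using hx) (by simpa using hs)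
          (by simpa using hk) (by rw [List.getD_cons_succ, List.getD_eq_getElem _ _ hk, hkE])
        omega
  · rintro ⟨h, h'⟩ j k h1 h2 h3 h4 h5
    rcases j with _ | j <;> rcases k with _ | k
    · simp_all
    · refine absurd ?_ (h' (by simpa using h2) ?_)
      · have hk : k < s.length := by simpa using h4
        rw [List.getD_cons_succ, List.getD_eq_getElem _ _ hk] at h5
        exact h5 ▸ List.getElem_mem hk
      · cases s with
        | nil => simp at h1
        | cons y s => simpa using h3
    · omega
    · have := h j k (by simpa using h1) (by simpa using h2) (by simpa using h3)
        (by simpa using h4) (by simpa using h5)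
      omega

theorem isNormal_iff (i : ℕ) (s : List Symb) :
    IsNormal i s ↔ s.count Symb.E ≤ i ∧ CaAfterE s ∧
      (s.count Symb.E < i → s.IsChain (fun x y => ¬(x = Symb.C ∧ y = Symb.A))) := by
  induction s generalizing i with
  | nil => simp [IsNormal, CaAfterE]
  | cons x s ih =>
    rw [caAfterE_cons]
    cases x with
    | A => simp [IsNormal, ih, List.isChain_cons]
    | B => simp [IsNormal, ih, List.isChain_cons]
    | C =>
      have hE : Symb.E ∉ s ↔ s.count Symb.E = 0 := List.count_eq_zero.symm
      simp only [IsNormal, ih, List.isChain_cons, hE]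
      simp
      grind
    | E =>
      cases i with
      | zero => simp [IsNormal]
      | succ i => simp [IsNormal, ih, List.isChain_cons]

theorem mem_Bni_iff {n i : ℕ} {s : List Symb} : s ∈ Bni n i ↔ degS s = n ∧ IsNormal i s := by
  rw [isNormal_iff]
  rfl

theorem two_mul_count_le_degS (s : List Symb) : 2 * s.count Symb.E ≤ degS s := by
  induction s with
  | nil => simp
  | cons x s ih => cases x <;> simp_all [degS, Symb.deg] <;> omega

theorem eq_E_of_degS_le (s : List Symb) (h : degS s ≤ 2 * s.count Symb.E) :
    ∀ x ∈ s, x = Symb.E := by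
  induction s with
  | nil => simp
  | cons x s ih =>
    have := two_mul_count_le_degS s
    cases x <;> simp_all [degS, Symb.deg] <;> first | omega | (apply ih; omega)

theorem Bni_zero (n : ℕ) : Bni n 0 = {s | degS s = n ∧ Symb.E ∉ s} := by
  ext s
  simp only [Bni, Set.mem_ofPred_eq, Nat.le_zero, List.count_eq_zero, Nat.not_lt_zero,
    false_imp_iff, and_true]
  refine and_congr_right fun _ => ⟨fun h => h.1, fun h => ⟨h, fun j k _ _ _ hk hE => ?_⟩⟩
  rw [List.getD_eq_getElem _ _ hk] at hE
  exact absurd (hE ▸ List.getElem_mem hk) h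

theorem caAfterE_of_isChain {s : List Symb}
    (h : s.IsChain (fun x y => ¬(x = Symb.C ∧ y = Symb.A))) : CaAfterE s := by
  induction s with
  | nil => simp [CaAfterE]
  | cons x s ih =>
    rw [List.isChain_cons] at h
    exact (caAfterE_cons x s).2 ⟨ih h.2, fun hx hs => absurd ⟨hx, rfl⟩ (h.1 _ hs)⟩

theorem Bni_eq_Bn {n i : ℕ} (h : n ≤ 2 * i) : Bni n i = Bn n := by
  ext s
  constructor
  · rintro ⟨hd, hc, -, hch⟩
    refine ⟨hd, ?_⟩
    rcases hc.lt_or_eq with hc | hc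
    · exact hch hc
    · have hall := eq_E_of_degS_le s (by omega)
      rw [List.eq_replicate_of_mem hall]
      exact List.isChain_replicate_of_rel _ (by simp)
  · rintro ⟨hd, hch⟩
    have := two_mul_count_le_degS s
    exact ⟨hd, by omega, caAfterE_of_isChain hch, fun _ => hch⟩

/-- The word in `{a, b, c}` obtained by replacing each `e` by `ca`. -/
def leadWord : List Symb → List (Fin 3)
  | [] => []
  | .A :: s => 0 :: leadWord s
  | .B :: s => 1 :: leadWord s
  | .C :: s => 2 :: leadWord s
  | .E :: s => 2 :: 0 :: leadWord s

theorem length_leadWord (s : List Symb) : (leadWord s).length = degS s := by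
  induction s with
  | nil => rfl
  | cons x s ih => cases x <;> simp_all [leadWord, degS, Symb.deg] <;> omega

theorem head?_of_leadWord_eq {s : List Symb} {w : List (Fin 3)} (h : leadWord s = 0 :: w) :
    s.head? = some .A := by
  rcases s with _ | ⟨_ | _ | _ | _, s⟩ <;> simp_all [leadWord]

theorem leadWord_injOn {i : ℕ} {s t : List Symb} (hs : IsNormal i s) (ht : IsNormal i t)
    (h : leadWord s = leadWord t) : s = t := by
  induction s generalizing i t with
  | nil => rcases t with _ | ⟨_ | _ | _ | _, t⟩ <;> simp_all [leadWord]
  | cons x s ih =>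
    rcases t with _ | ⟨y, t⟩
    · cases x <;> simp [leadWord] at h
    · cases i <;> cases x <;> cases y <;> simp [leadWord, IsNormal] at h hs ht <;>
        first
        | rw [ih hs ht h]
        | rw [ih hs.1 ht.1 h]
        | exact absurd (head?_of_leadWord_eq h) hs.2
        | exact absurd (head?_of_leadWord_eq h.symm) ht.2

theorem card_Bni (n i : ℕ) : Finite (Bni n i) ∧ Nat.card (Bni n i) ≤ 3 ^ n := by
  let f : Bni n i → List.Vector (Fin 3) n :=
    fun s => ⟨leadWord s, (length_leadWord s).trans s.2.1⟩
  have hf : Function.Injective f := fun s t h =>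
    Subtype.ext (leadWord_injOn (mem_Bni_iff.1 s.2).2 (mem_Bni_iff.1 t.2).2
      (congrArg Subtype.val h))
  refine ⟨Finite.of_injective f hf, (Nat.card_le_card_of_injective f hf).trans ?_⟩
  simp [Nat.card_eq_fintype_card, card_vector]

theorem finrank_tensorPower (n : ℕ) : Module.finrank Ftwo (⨂[Ftwo]^n V) = 3 ^ n := by
  rw [Module.finrank_eq_card_basis
    (Basis.piTensorProduct fun _ : Fin n => Pi.basisFun Ftwo (Fin 3))]
  simp

theorem toTensorAlgebra_injective (n : ℕ) :
    Function.Injective (TensorPower.toTensorAlgebra : ⨂[Ftwo]^n V →ₗ[Ftwo] _) := by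
  intro x y h
  have key (z : ⨂[Ftwo]^n V) : TensorPower.toTensorAlgebra z =
      TensorAlgebra.ofDirectSum (DirectSum.of (fun n => ⨂[Ftwo]^n V) n z) :=
    (DirectSum.toAddMonoid_of
      (fun _ ↦ LinearMap.toAddMonoidHom TensorPower.toTensorAlgebra) _ _).symm
  rw [key, key] at h
  exact DirectSum.of_injective (β := fun n => ⨂[Ftwo]^n V) n
    (TensorAlgebra.equivDirectSum.symm.injective h)

/-- The value of a symbol in the tensor algebra. -/
noncomputable def symT : Symb → TensorAlgebra Ftwo V
  | .A => TensorAlgebra.ι Ftwo va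
  | .B => TensorAlgebra.ι Ftwo vb
  | .C => TensorAlgebra.ι Ftwo vc
  | .E => TensorAlgebra.ι Ftwo va * TensorAlgebra.ι Ftwo vc +
      TensorAlgebra.ι Ftwo vc * TensorAlgebra.ι Ftwo va

/-- The value of a string in the tensor algebra. -/
noncomputable def stringT (s : List Symb) : TensorAlgebra Ftwo V := (s.map symT).prod

theorem stringT_cons (x : Symb) (s : List Symb) : stringT (x :: s) = symT x * stringT s := by
  simp [stringT]

theorem toTensorAlgebra_symVal (x : Symb) : TensorPower.toTensorAlgebra (symVal x) = symT x := by
  cases x with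
  | E =>
    refine (map_add (TensorPower.toTensorAlgebra (n := 2)) _ _).trans ?_
    simp [symT, TensorAlgebra.tprod_apply]
  | _ =>
    refine (TensorPower.toTensorAlgebra_tprod (n := 1) _).trans ?_
    simp [symT, TensorAlgebra.tprod_apply]

theorem toTensorAlgebra_interp (s : List Symb) :
    TensorPower.toTensorAlgebra (interp s) = stringT s := by
  induction s with
  | nil => exact TensorPower.toTensorAlgebra_gOne
  | cons x s ih =>
    rw [stringT_cons, ← ih, ← toTensorAlgebra_symVal]
    exact TensorPower.toTensorAlgebra_gMul _ _

theorem toTensorAlgebra_interpN (n : ℕ) (s : List Symb) (h : degS s = n) :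
    TensorPower.toTensorAlgebra (interpN n s h) = stringT s := by
  subst h
  rw [interpN, TensorPower.cast_refl]
  exact toTensorAlgebra_interp s

theorem range_toTensorAlgebra_le (n : ℕ) :
    LinearMap.range (TensorPower.toTensorAlgebra : ⨂[Ftwo]^n V →ₗ[Ftwo] _) ≤
      LinearMap.range (TensorAlgebra.ι Ftwo : V →ₗ[Ftwo] _) ^ n := by
  rw [LinearMap.range_eq_map, ← PiTensorProduct.span_tprod_eq_top, Submodule.map_span,
    Submodule.span_le]
  rintro _ ⟨_, ⟨v, rfl⟩, rfl⟩
  rw [TensorPower.toTensorAlgebra_tprod, TensorAlgebra.tprod_apply, SetLike.mem_coe]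
  induction n with
  | zero => simp
  | succ n ih =>
    rw [List.ofFn_succ, List.prod_cons, pow_succ']
    exact Submodule.mul_mem_mul (LinearMap.mem_range_self _ _) (ih _)

theorem stringT_mem (s : List Symb) :
    stringT s ∈ LinearMap.range (TensorAlgebra.ι Ftwo : V →ₗ[Ftwo] _) ^ degS s := by
  rw [← toTensorAlgebra_interp]
  exact range_toTensorAlgebra_le _ (LinearMap.mem_range_self _ _)

theorem range_ι_mul_le {P Q : Submodule Ftwo (TensorAlgebra Ftwo V)}
    (hA : ∀ x ∈ P, symT .A * x ∈ Q) (hB : ∀ x ∈ P, symT .B * x ∈ Q)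
    (hC : ∀ x ∈ P, symT .C * x ∈ Q) :
    LinearMap.range (TensorAlgebra.ι Ftwo : V →ₗ[Ftwo] _) * P ≤ Q := by
  rw [Submodule.mul_le]
  rintro _ ⟨v, rfl⟩ x hx
  have hv : v = v 0 • va + v 1 • vb + v 2 • vc := by
    ext k
    fin_cases k <;> simp [va, vb, vc]
  rw [hv]
  simp only [map_add, map_smul, add_mul, smul_mul_assoc]
  exact Q.add_mem (Q.add_mem (Q.smul_mem _ (hA x hx)) (Q.smul_mem _ (hB x hx)))
    (Q.smul_mem _ (hC x hx))

/-- Left multiplication maps a span into a submodule as soon as it does so on generators. -/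
theorem mul_mem_of_mem_span_image {S : Set (List Symb)} {Q : Submodule Ftwo (TensorAlgebra Ftwo V)}
    (y : TensorAlgebra Ftwo V) (h : ∀ s ∈ S, y * stringT s ∈ Q) {x : TensorAlgebra Ftwo V}
    (hx : x ∈ Submodule.span Ftwo (stringT '' S)) : y * x ∈ Q := by
  have : Submodule.span Ftwo (stringT '' S) ≤ Q.comap (LinearMap.mulLeft Ftwo y) := by
    rw [Submodule.span_le]
    rintro _ ⟨s, hs, rfl⟩
    exact h s hs
  exact this hx

theorem pow_le_span_stringT (n i : ℕ) :
    LinearMap.range (TensorAlgebra.ι Ftwo : V →ₗ[Ftwo] _) ^ n ≤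
      Submodule.span Ftwo (stringT '' Bni n i) := by
  induction n using Nat.strong_induction_on generalizing i with
  | _ n ih =>
  rcases n with _ | n
  · rw [pow_zero, Submodule.one_le]
    exact Submodule.subset_span ⟨[], mem_Bni_iff.2 ⟨rfl, trivial⟩, by simp [stringT]⟩
  have cons_mem {x : Symb} {s : List Symb} (h : degS (x :: s) = n + 1)
      (h' : IsNormal i (x :: s)) :
      symT x * stringT s ∈ Submodule.span Ftwo (stringT '' Bni (n + 1) i) :=
    Submodule.subset_span ⟨_, mem_Bni_iff.2 ⟨h, h'⟩, stringT_cons _ _⟩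
  have hA {x} (hx : x ∈ LinearMap.range (TensorAlgebra.ι Ftwo : V →ₗ[Ftwo] _) ^ n) :
      symT .A * x ∈ Submodule.span Ftwo (stringT '' Bni (n + 1) i) := by
    refine mul_mem_of_mem_span_image _ (fun s hs => ?_) (ih n n.lt_succ_self i hx)
    obtain ⟨hd, hs⟩ := mem_Bni_iff.1 hs
    exact cons_mem (by simp_all [degS, Symb.deg]; omega) hs
  rw [pow_succ']
  refine range_ι_mul_le (fun x hx => hA hx) (fun x hx => ?_) (fun x hx => ?_)
  · refine mul_mem_of_mem_span_image _ (fun s hs => ?_) (ih n n.lt_succ_self i hx)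
    obtain ⟨hd, hs⟩ := mem_Bni_iff.1 hs
    exact cons_mem (by simp_all [degS, Symb.deg]; omega) hs
  · refine mul_mem_of_mem_span_image _ (fun s hs => ?_) (ih n n.lt_succ_self i hx)
    obtain ⟨hd, hs⟩ := mem_Bni_iff.1 hs
    by_cases hca : i ≠ 0 → s.head? ≠ some .A
    · exact cons_mem (by simp_all [degS, Symb.deg]; omega) ⟨hs, hca⟩
    · push Not at hca
      obtain ⟨hi, hsA⟩ := hca
      obtain ⟨i, rfl⟩ := Nat.exists_eq_succ_of_ne_zero hi
      obtain ⟨t, rfl⟩ := List.head?_eq_some_iff.1 hsA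
      have hdt : degS t + 1 = n := by
        simp only [degS, List.map_cons, List.sum_cons, Symb.deg] at hd ⊢
        omega
      have hE : symT .E * stringT t ∈
          Submodule.span Ftwo (stringT '' Bni (n + 1) (i + 1)) := by
        refine mul_mem_of_mem_span_image _ (fun u hu => ?_)
          (ih (degS t) (by omega) i (stringT_mem t))
        obtain ⟨hd, hu⟩ := mem_Bni_iff.1 hu
        refine cons_mem ?_ hu
        simp only [degS, List.map_cons, List.sum_cons, Symb.deg] at hd hdt ⊢
        omega
      have hC : symT .C * stringT t ∈
          LinearMap.range (TensorAlgebra.ι Ftwo : V →ₗ[Ftwo] _) ^ n := by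
        rw [← hdt, pow_succ']
        exact Submodule.mul_mem_mul (LinearMap.mem_range_self _ _) (stringT_mem t)
      have key : symT .C * stringT (.A :: t) =
          symT .E * stringT t - symT .A * (symT .C * stringT t) := by
        rw [stringT_cons]
        simp only [symT]
        noncomm_ring
      rw [key]
      exact Submodule.sub_mem _ hE (hA hC)

theorem span_interpFam_Bni (n i : ℕ) :
    Submodule.span Ftwo (Set.range (interpFam n (Bni n i) (fun _ hs => hs.1))) = ⊤ := by
  apply Submodule.map_injective_of_injective (toTensorAlgebra_injective n)
  refine le_antisymm (Submodule.map_mono le_top) ?_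
  rw [← LinearMap.range_eq_map, Submodule.map_span]
  refine (range_toTensorAlgebra_le n).trans ((pow_le_span_stringT n i).trans ?_)
  refine Submodule.span_mono ?_
  rintro _ ⟨s, hs, rfl⟩
  exact ⟨_, ⟨⟨s, hs⟩, rfl⟩, toTensorAlgebra_interpN n s hs.1⟩

theorem linearIndependent_interpFam_Bni (n i : ℕ) :
    LinearIndependent Ftwo (interpFam n (Bni n i) (fun _ hs => hs.1)) := by
  obtain ⟨hfin, hcard⟩ := card_Bni n i
  have := Fintype.ofFinite (Bni n i)
  refine linearIndependent_of_top_le_span_of_card_le_finrank (span_interpFam_Bni n i).ge ?_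
  rwa [finrank_tensorPower, ← Nat.card_eq_fintype_card]

/-- **Statement 4.** For each `n ≥ 0` and `i ≥ 0`, the set `ℬ^{n,i}` is a basis of the
`F₂`-vector space `V^{⊗n}`; in particular `ℬ^{n,0}` is the standard monomial basis in the
symbols `{a, b, c}`, and `ℬ^{n,i} = ℬⁿ` for `i ≥ n/2` (i.e. `n ≤ 2i`). -/
theorem stmt4 :
    (∀ n i : ℕ,
      LinearIndependent Ftwo (interpFam n (Bni n i) (fun _ hs => hs.1)) ∧
      Submodule.span Ftwo (Set.range (interpFam n (Bni n i) (fun _ hs => hs.1))) = ⊤) ∧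
    (∀ n : ℕ, Bni n 0 = {s | degS s = n ∧ Symb.E ∉ s}) ∧
    (∀ n i : ℕ, n ≤ 2 * i → Bni n i = Bn n) :=
  ⟨fun n i => ⟨linearIndependent_interpFam_Bni n i, span_interpFam_Bni n i⟩, Bni_zero,
    fun _ _ => Bni_eq_Bn⟩
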